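/- Let k be a finite field with q elements and char(k) ≠ 2 and char(k) ≠ 3. Then the number of orbits of SL(2,k) acting on the set of binary cubics P over k with Q_n(P) ≠ 0 is exactly 2(q−1). -/

import Mathlib

open MvPolynomial

/-- A binary cubic `a·x³ + 3b·x²y + 3c·xy² + d·y³`, recorded by its coefficients. -/
structure BinCubic (k : Type*) where
  a : k
  b : k
  c : k
  d : k

namespace BinCubic

variable {k : Type*} [Field k]

instance : Zero (BinCubic k) := ⟨⟨0, 0, 0, 0⟩⟩

instance : Add (BinCubic k) :=
  ⟨fun P Q => ⟨P.a + Q.a, P.b + Q.b, P.c + Q.c, P.d + Q.d⟩⟩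

instance : Neg (BinCubic k) := ⟨fun P => ⟨-P.a, -P.b, -P.c, -P.d⟩⟩

instance : Sub (BinCubic k) :=
  ⟨fun P Q => ⟨P.a - Q.a, P.b - Q.b, P.c - Q.c, P.d - Q.d⟩⟩

instance : SMul k (BinCubic k) := ⟨fun t P => ⟨t * P.a, t * P.b, t * P.c, t * P.d⟩⟩

/-- The homogeneous cubic polynomial in `k[x,y]` attached to a binary cubic. -/
noncomputable def toPoly (P : BinCubic k) : MvPolynomial (Fin 2) k :=
  C P.a * X 0 ^ 3 + C (3 * P.b) * X 0 ^ 2 * X 1 +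
    C (3 * P.c) * X 0 * X 1 ^ 2 + C P.d * X 1 ^ 3

/-- The linear form `e·x + f·y`. -/
noncomputable def lin (e f : k) : MvPolynomial (Fin 2) k := C e * X 0 + C f * X 1

/-- A binary quadratic `u·x² + v·xy + w·y²`. -/
noncomputable def quadPoly (u v w : k) : MvPolynomial (Fin 2) k :=
  C u * X 0 ^ 2 + C v * (X 0 * X 1) + C w * X 1 ^ 2

/-- The moment map `μ`. -/
def mu (P : BinCubic k) : Matrix (Fin 2) (Fin 2) k :=
  !![P.a * P.d - P.b * P.c, 2 * (P.b * P.d - P.c ^ 2);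
     2 * (P.b ^ 2 - P.a * P.c), -(P.a * P.d - P.b * P.c)]

/-- The normalized quartic invariant `Q_n`. -/
def Qn (P : BinCubic k) : k :=
  P.a ^ 2 * P.d ^ 2 - 3 * P.b ^ 2 * P.c ^ 2 - 6 * P.a * P.b * P.c * P.d +
    4 * P.b ^ 3 * P.d + 4 * P.a * P.c ^ 3

/-- The derivation action of the trace-free matrix `M = [[α,β],[γ,−α]]` on binary cubics,
induced by `M·x = −αx − βy`, `M·y = −γx + αy`.  Explicitly,
`M·P = (−3aα−3bγ)x³ + (−3aβ−3bα−6cγ)x²y + (−6bβ+3cα−3dγ)xy² + (−3cβ+3dα)y³`. -/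
def matAct (M : Matrix (Fin 2) (Fin 2) k) (P : BinCubic k) : BinCubic k :=
  ⟨-(3 * P.a * M 0 0) - 3 * P.b * M 1 0,
   -(P.a * M 0 1) - P.b * M 0 0 - 2 * P.c * M 1 0,
   -(2 * P.b * M 0 1) + P.c * M 0 0 - P.d * M 1 0,
   -(3 * P.c * M 0 1) + 3 * P.d * M 0 0⟩

/-- The cubic covariant `Ψ(P) = μ(P)·P`. -/
def Psi (P : BinCubic k) : BinCubic k := matAct (mu P) P

/-- The symplectic form `ω` on binary cubics. -/
def omega (P Q : BinCubic k) : k :=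
  P.a * Q.d - P.d * Q.a - 3 * P.b * Q.c + 3 * P.c * Q.b

/-- `λ·(ex+fy)³` as a binary cubic. -/
def cubeForm (lam e f : k) : BinCubic k :=
  ⟨lam * e ^ 3, lam * e ^ 2 * f, lam * e * f ^ 2, lam * f ^ 3⟩

/-- The action on binary cubics of the algebra substitution `x ↦ px + qy`, `y ↦ rx + sy`. -/
def substAct (p q r s : k) (P : BinCubic k) : BinCubic k :=
  ⟨P.a * p ^ 3 + 3 * P.b * p ^ 2 * r + 3 * P.c * p * r ^ 2 + P.d * r ^ 3,
   P.a * p ^ 2 * q + P.b * (p ^ 2 * s + 2 * p * q * r) + P.c * (2 * p * r * s + q * r ^ 2) +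
     P.d * r ^ 2 * s,
   P.a * p * q ^ 2 + P.b * (2 * p * q * s + q ^ 2 * r) + P.c * (p * s ^ 2 + 2 * q * r * s) +
     P.d * r * s ^ 2,
   P.a * q ^ 3 + 3 * P.b * q ^ 2 * s + 3 * P.c * q * s ^ 2 + P.d * s ^ 3⟩

/-- `M^{⊗3}` acting on binary cubics for a trace-free `M = [[α,β],[γ,−α]]`: the algebra
substitution `x ↦ −αx − βy`, `y ↦ −γx + αy`; it sends `φ³` to `(M·φ)³` for linear forms `φ`. -/
def tensorCubeAct (M : Matrix (Fin 2) (Fin 2) k) (P : BinCubic k) : BinCubic k :=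
  substAct (-(M 0 0)) (-(M 0 1)) (-(M 1 0)) (M 0 0) P

/-- Action of a trace-free matrix `M = [[α,β],[γ,−α]]` on the linear form `ex + fy`
(`M·x = −αx − βy`, `M·y = −γx + αy`), recorded by the resulting pair of coefficients. -/
def linAct (M : Matrix (Fin 2) (Fin 2) k) (e f : k) : k × k :=
  (-(e * M 0 0) - f * M 1 0, -(e * M 0 1) + f * M 0 0)

/-- Evaluation of `P` at the point `(u, w) ∈ k²`. -/
def evalAt (P : BinCubic k) (u w : k) : k :=
  P.a * u ^ 3 + 3 * P.b * u ^ 2 * w + 3 * P.c * u * w ^ 2 + P.d * w ^ 3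

/-- The symplectic form `Ω` on `k²`. -/
def Omeg (v w : Fin 2 → k) : k := v 0 * w 1 - v 1 * w 0

/-- The action of `g = [[α,β],[γ,δ]]` on polynomials by the algebra substitution
`g·x = δx − βy`, `g·y = −γx + αy`. -/
noncomputable def slAct (g : Matrix (Fin 2) (Fin 2) k) (P : MvPolynomial (Fin 2) k) :
    MvPolynomial (Fin 2) k :=
  aeval ![C (g 1 1) * X 0 - C (g 0 1) * X 1, C (g 0 0) * X 1 - C (g 1 0) * X 0] P

/-- The symmetric bilinear polarization `B_μ` of the moment map: `B_μ(P,P) = μ(P)`. -/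
def Bmu (P Q : BinCubic k) : Matrix (Fin 2) (Fin 2) k :=
  !![(P.a * Q.d + P.d * Q.a - P.b * Q.c - P.c * Q.b) / 2,
       (P.b * Q.d + P.d * Q.b) - P.c * Q.c;
     P.b * Q.b - (P.a * Q.c + P.c * Q.a),
       -((P.a * Q.d + P.d * Q.a - P.b * Q.c - P.c * Q.b) / 2)]

/-- `P` is reducible over `k`: it factors as (nonzero linear form)·(binary quadratic). -/
def IsReducible (P : BinCubic k) : Prop :=
  ∃ e f u v w : k, (e ≠ 0 ∨ f ≠ 0) ∧ toPoly P = lin e f * quadPoly u v w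

end BinCubic

open BinCubic

namespace BinCubic

@[ext] theorem ext {k : Type*} {P R : BinCubic k} (ha : P.a = R.a) (hb : P.b = R.b)
    (hc : P.c = R.c) (hd : P.d = R.d) : P = R := by
  cases P; cases R; simp_all

variable {k : Type*} [Field k]

theorem toPoly_injective (h2 : (2 : k) ≠ 0) (h3 : (3 : k) ≠ 0) :
    Function.Injective (toPoly (k := k)) := by
  intro P R h
  have key (x y : k) := congrArg (MvPolynomial.eval ![x, y]) h
  simp only [toPoly, map_add, map_mul, map_pow, MvPolynomial.eval_C, MvPolynomial.eval_X,
    Matrix.cons_val_zero, Matrix.cons_val_one] at key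
  have ha : P.a = R.a := by linear_combination key 1 0
  have hd : P.d = R.d := by linear_combination key 0 1
  have h6 : (2 * 3 : k) ≠ 0 := mul_ne_zero h2 h3
  refine ext ha (mul_left_cancel₀ h6 ?_) (mul_left_cancel₀ h6 ?_) hd
  · linear_combination key 1 1 - key 1 (-1) - 2 * hd
  · linear_combination key 1 1 + key 1 (-1) - 2 * ha

/-- `SL(2,k)` acts on binary cubics by the substitution defining `slAct`. -/
instance : MulAction (Matrix.SpecialLinearGroup (Fin 2) k) (BinCubic k) where
  smul g P := substAct (g.1 1 1) (-g.1 0 1) (-g.1 1 0) (g.1 0 0) P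
  one_smul P := by
    change substAct _ _ _ _ P = P
    ext <;> simp [substAct]
  mul_smul g h P := by
    change substAct _ _ _ _ P = substAct _ _ _ _ (substAct _ _ _ _ P)
    ext <;> simp only [substAct, Matrix.SpecialLinearGroup.coe_mul, Matrix.mul_apply,
      Fin.sum_univ_two] <;> ring

theorem sl_smul_def (g : Matrix.SpecialLinearGroup (Fin 2) k) (P : BinCubic k) :
    g • P = substAct (g.1 1 1) (-g.1 0 1) (-g.1 1 0) (g.1 0 0) P := rfl

theorem slAct_toPoly (g : Matrix.SpecialLinearGroup (Fin 2) k) (P : BinCubic k) :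
    slAct g (toPoly P) = toPoly (g • P) := by
  simp only [sl_smul_def, slAct, toPoly, substAct, map_add, map_mul, map_pow, map_neg, aeval_X,
    aeval_C, algebraMap_eq, Matrix.cons_val_zero, Matrix.cons_val_one, map_ofNat]
  ring

theorem Qn_substAct (p q r s : k) (P : BinCubic k) :
    Qn (substAct p q r s P) = (p * s - q * r) ^ 6 * Qn P := by
  simp only [Qn, substAct]
  ring

theorem det_eq_one (g : Matrix.SpecialLinearGroup (Fin 2) k) :
    g.1 0 0 * g.1 1 1 - g.1 0 1 * g.1 1 0 = 1 := by
  rw [← Matrix.det_fin_two, g.2]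

theorem Qn_sl_smul (g : Matrix.SpecialLinearGroup (Fin 2) k) (P : BinCubic k) :
    Qn (g • P) = Qn P := by
  rw [sl_smul_def, Qn_substAct]
  linear_combination (exp := 1) Qn P * congrArg (· ^ 6) (det_eq_one g)

theorem mu_substAct (p q r s : k) (P : BinCubic k) :
    mu (substAct p q r s P) * !![s, -q; -r, p] =
      (p * s - q * r) ^ 3 • (!![s, -q; -r, p] * mu P) := by
  ext i j
  fin_cases i <;> fin_cases j <;>
    simp [mu, substAct, Matrix.mul_apply, Fin.sum_univ_two] <;> ring

theorem substAct_mu (h3 : (3 : k) ≠ 0) (s t : k) (P : BinCubic k) :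
    substAct (s - t * mu P 0 0) (-(t * mu P 0 1)) (-(t * mu P 1 0)) (s - t * mu P 1 1) P =
      let u := s ^ 3 + 3 * s * t ^ 2 * Qn P
      let v := s ^ 2 * t + t ^ 3 * Qn P / 3
      ⟨u * P.a + v * (Psi P).a, u * P.b + v * (Psi P).b, u * P.c + v * (Psi P).c,
        u * P.d + v * (Psi P).d⟩ := by
  ext <;> simp [substAct, mu, Psi, matAct, Qn] <;> field_simp <;> ring

theorem omega_substAct_mu (s t : k) (P : BinCubic k) :
    omega P (substAct (s - t * mu P 0 0) (-(t * mu P 0 1)) (-(t * mu P 1 0))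
      (s - t * mu P 1 1) P) = 2 * Qn P * (t * (3 * s ^ 2 + t ^ 2 * Qn P)) := by
  simp [omega, substAct, mu, Qn]
  ring

section Stabilizer

open Matrix

theorem mu_mul_self (P : BinCubic k) : mu P * mu P = Qn P • (1 : Matrix (Fin 2) (Fin 2) k) := by
  ext i j
  fin_cases i <;> fin_cases j <;> simp [mu, Qn, Matrix.mul_apply, Fin.sum_univ_two] <;> ring

theorem sl_smul_of_eq {g : SpecialLinearGroup (Fin 2) k} {s t : k} {P : BinCubic k}
    (hg : g.1 = s • (1 : Matrix (Fin 2) (Fin 2) k) + t • mu P) :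
    g • P = substAct (s - t * mu P 0 0) (-(t * mu P 0 1)) (-(t * mu P 1 0))
      (s - t * mu P 1 1) P := by
  rw [sl_smul_def, hg]
  congr 1 <;> simp [mu] <;> ring

theorem mu_mul_comm {g : SpecialLinearGroup (Fin 2) k} {P : BinCubic k} (h : g • P = P) :
    mu P * g.1 = g.1 * mu P := by
  have := mu_substAct (g.1 1 1) (-g.1 0 1) (-g.1 1 0) (g.1 0 0) P
  rw [← sl_smul_def, h, neg_neg, neg_neg, ← Matrix.eta_fin_two g.1] at this
  rw [this, neg_mul_neg, mul_comm (g.1 1 1), det_eq_one, one_pow, one_smul]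

/-- A matrix commuting with `μ(P)`, for `Q_n(P) ≠ 0`, is a polynomial in `μ(P)`. -/
theorem exists_eq_of_commute (h2 : (2 : k) ≠ 0) {M : Matrix (Fin 2) (Fin 2) k} {P : BinCubic k}
    (hP : Qn P ≠ 0) (h : mu P * M = M * mu P) :
    ∃ s t : k, M = s • (1 : Matrix (Fin 2) (Fin 2) k) + t • mu P := by
  have hQ := congrFun₂ (mu_mul_self P) 0 0
  have h00 := congrFun₂ h 0 0
  have h01 := congrFun₂ h 0 1
  have h10 := congrFun₂ h 1 0
  have h11 : mu P 1 1 = -mu P 0 0 := by simp [mu]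
  simp only [Matrix.mul_apply, Fin.sum_univ_two, h11, Matrix.smul_apply, Matrix.one_apply_eq,
    smul_eq_mul, mul_one] at hQ h00 h01 h10
  refine ⟨(M 0 0 + M 1 1) / 2,
    ((M 0 0 - M 1 1) * mu P 0 0 / 2 + M 0 1 * mu P 1 0) / Qn P, ?_⟩
  generalize Qn P = Q at *
  ext i j
  fin_cases i <;> fin_cases j <;> simp [h11] <;> field_simp
  · linear_combination -mu P 1 0 * h01 - (M 0 0 - M 1 1) * hQ
  · linear_combination mu P 0 0 * h01 - 2 * M 0 1 * hQ
  · linear_combination -mu P 0 0 * h10 + 2 * mu P 1 0 * h00 - 2 * M 1 0 * hQ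
  · linear_combination mu P 1 0 * h01 + (M 0 0 - M 1 1) * hQ

theorem sl_smul_eq_self_iff (h2 : (2 : k) ≠ 0) (h3 : (3 : k) ≠ 0)
    (g : SpecialLinearGroup (Fin 2) k) {P : BinCubic k} (hP : Qn P ≠ 0) :
    g • P = P ↔ g = 1 ∨ ∃ t : k, 4 * t ^ 2 * Qn P = -3 ∧
      g.1 = (-1 / 2 : k) • (1 : Matrix (Fin 2) (Fin 2) k) + t • mu P := by
  constructor
  · intro h
    obtain ⟨s, t, hg⟩ := exists_eq_of_commute h2 hP (mu_mul_comm h)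
    have hdet : s ^ 2 - t ^ 2 * Qn P = 1 := by
      have := det_eq_one g
      rw [hg] at this
      simp only [mu, Qn] at this ⊢
      simp at this
      linear_combination this
    have hs := sl_smul_of_eq hg
    rw [h] at hs
    have hom := omega_substAct_mu s t P
    rw [← hs] at hom
    have hself : omega P P = 0 := by simp only [omega]; ring
    have ht : t * (3 * s ^ 2 + t ^ 2 * Qn P) = 0 :=
      (mul_eq_zero.mp (hom.symm.trans hself)).resolve_left (mul_ne_zero h2 hP)
    have hv : s ^ 2 * t + t ^ 3 * Qn P / 3 = 0 := by
      field_simp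
      linear_combination ht
    rw [substAct_mu h3, hv] at hs
    have hu : s ^ 3 + 3 * s * t ^ 2 * Qn P = 1 := by
      by_contra hu
      have hz {x : k} (hx : x = (s ^ 3 + 3 * s * t ^ 2 * Qn P) * x) : x = 0 := by
        by_contra hx0
        exact hu (mul_right_cancel₀ hx0 (hx.symm.trans (one_mul x).symm))
      have ha := hz (by simpa using congrArg BinCubic.a hs)
      have hb := hz (by simpa using congrArg BinCubic.b hs)
      exact hP (by simp [Qn, ha, hb])
    rcases mul_eq_zero.mp ht with rfl | ht
    · left
      have : s = 1 := by linear_combination hu - s * hdet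
      ext1 i j
      simp [hg, this]
    · right
      have hs : s = -1 / 2 := by
        field_simp
        linear_combination s * ht - 2 * s * hdet - hu
      refine ⟨t, ?_, hs ▸ hg⟩
      have h4 : (4 : k) * s ^ 2 = 1 := by linear_combination ht + hdet
      linear_combination 4 * ht - 3 * h4
  · rintro (rfl | ⟨t, ht, hg⟩)
    · exact one_smul _ P
    · rw [sl_smul_of_eq hg, substAct_mu h3]
      have hu : (-1 / 2 : k) ^ 3 + 3 * (-1 / 2) * t ^ 2 * Qn P = 1 := by
        field_simp
        linear_combination (-3) * ht
      have hv : (-1 / 2 : k) ^ 2 * t + t ^ 3 * Qn P / 3 = 0 := by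
        field_simp
        linear_combination t * ht
      ext <;> simp [hu, hv]

/-- The element `-1/2 + t μ(P)` of order three. -/
def orderThree (h2 : (2 : k) ≠ 0) (t : k) (P : BinCubic k) (h : 4 * t ^ 2 * Qn P = -3) :
    SpecialLinearGroup (Fin 2) k :=
  ⟨(-1 / 2 : k) • (1 : Matrix (Fin 2) (Fin 2) k) + t • mu P, by
    rw [Matrix.det_fin_two]
    simp only [Qn] at h
    simp [mu]
    field_simp
    linear_combination -h⟩

theorem orderThree_smul (h2 : (2 : k) ≠ 0) (h3 : (3 : k) ≠ 0) {t : k} {P : BinCubic k}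
    (h : 4 * t ^ 2 * Qn P = -3) : orderThree h2 t P h • P = P := by
  have hP : Qn P ≠ 0 := by
    intro h0
    rw [h0, mul_zero] at h
    exact h3 (neg_eq_zero.mp h.symm)
  exact (sl_smul_eq_self_iff h2 h3 _ hP).mpr (Or.inr ⟨t, h, rfl⟩)

theorem orderThree_ne_one (h2 : (2 : k) ≠ 0) (h3 : (3 : k) ≠ 0) {t : k} {P : BinCubic k}
    (h : 4 * t ^ 2 * Qn P = -3) : orderThree h2 t P h ≠ 1 := by
  intro he
  have h00 := congrFun₂ (congrArg Subtype.val he) 0 0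
  have h11 := congrFun₂ (congrArg Subtype.val he) 1 1
  simp [orderThree, mu] at h00 h11
  field_simp at h00 h11
  have : (2 * 3 : k) = 0 := by linear_combination -h00 - h11
  exact mul_ne_zero h2 h3 this

theorem orderThree_injective (h2 : (2 : k) ≠ 0) {t t' : k} {P : BinCubic k} (hP : Qn P ≠ 0)
    {h : 4 * t ^ 2 * Qn P = -3} {h' : 4 * t' ^ 2 * Qn P = -3}
    (he : orderThree h2 t P h = orderThree h2 t' P h') : t = t' := by
  have hmu : t • mu P = t' • mu P := add_left_cancel (congrArg Subtype.val he)
  have hne : mu P ≠ 0 := by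
    intro h0
    have := congrFun₂ (mu_mul_self P) 0 0
    rw [h0] at this
    simp at this
    exact hP this.symm
  exact smul_left_injective k hne hmu

end Stabilizer

section Counting

open Matrix

instance [Finite k] : Finite (BinCubic k) :=
  Finite.of_injective (fun P : BinCubic k => (P.a, P.b, P.c, P.d)) fun P R h => by
    simp only [Prod.mk.injEq] at h
    exact ext h.1 h.2.1 h.2.2.1 h.2.2.2

open Classical in
/-- A parametrization of the binary cubics with `Q_n = D`: those with `a = 0`, by `b` and `c`,
and those with `a ≠ 0`, through the syzygy `G² + 4H³ = a²Q_n`, where `H = ac - b²` and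
`G = a²d - 3abc + 2b³`. -/
noncomputable def levelParam (D : k) : (kˣ × k) ⊕ (k × kˣ × k) → BinCubic k
  | .inl (b, c) => ⟨0, b, c, (D + 3 * b ^ 2 * c ^ 2) / (4 * b ^ 3)⟩
  | .inr (b, t, u) =>
    let a : k := if u ^ 2 = D then (t : k) else (D - u ^ 2) / (4 * t ^ 3)
    let c : k := (if u ^ 2 = D then 0 else (t : k)) + b ^ 2 / a
    ⟨a, b, c, (a * u + 3 * a * b * c - 2 * b ^ 3) / a ^ 2⟩

theorem four_ne_zero_of_two (h2 : (2 : k) ≠ 0) : (4 : k) ≠ 0 := by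
  have : (4 : k) = 2 * 2 := by norm_num
  rw [this]
  exact mul_ne_zero h2 h2

theorem levelParam_inr_a_ne_zero (h2 : (2 : k) ≠ 0) (D : k) (x : k × kˣ × k) :
    (levelParam D (.inr x)).a ≠ 0 := by
  obtain ⟨b, t, u⟩ := x
  have h4 := four_ne_zero_of_two h2
  simp only [levelParam]
  split_ifs with hu
  · exact t.ne_zero
  · exact div_ne_zero (sub_ne_zero.mpr (Ne.symm hu)) (mul_ne_zero h4 (pow_ne_zero _ t.ne_zero))

theorem Qn_eq_iff {P : BinCubic k} (ha : P.a ≠ 0) (D : k) :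
    Qn P = D ↔ (P.a ^ 2 * P.d - 3 * P.a * P.b * P.c + 2 * P.b ^ 3) ^ 2 +
      4 * (P.a * P.c - P.b ^ 2) ^ 3 = P.a ^ 2 * D := by
  rw [← mul_right_inj' (pow_ne_zero 2 ha)]
  simp only [Qn]
  constructor <;> intro h <;> linear_combination h

theorem levelParam_H (h2 : (2 : k) ≠ 0) (D : k) (b : k) (t : kˣ) (u : k) :
    let P := levelParam D (.inr (b, t, u))
    P.a * P.c - P.b ^ 2 = P.a * (open Classical in if u ^ 2 = D then 0 else (t : k)) := by
  intro P
  have ha : P.a ≠ 0 := levelParam_inr_a_ne_zero h2 D _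
  have hc : P.c = (open Classical in if u ^ 2 = D then 0 else (t : k)) + b ^ 2 / P.a := rfl
  have hb : P.b = b := rfl
  rw [hc, hb]
  field_simp
  ring

theorem levelParam_G (h2 : (2 : k) ≠ 0) (D : k) (b : k) (t : kˣ) (u : k) :
    let P := levelParam D (.inr (b, t, u))
    P.a ^ 2 * P.d - 3 * P.a * P.b * P.c + 2 * P.b ^ 3 = P.a * u := by
  intro P
  have ha : P.a ≠ 0 := levelParam_inr_a_ne_zero h2 D _
  have hd : P.d = (P.a * u + 3 * P.a * P.b * P.c - 2 * P.b ^ 3) / P.a ^ 2 := rfl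
  rw [hd]
  field_simp
  ring

theorem Qn_levelParam (h2 : (2 : k) ≠ 0) (D : k) (x : (kˣ × k) ⊕ (k × kˣ × k)) :
    Qn (levelParam D x) = D := by
  have h4 := four_ne_zero_of_two h2
  rcases x with ⟨b, c⟩ | ⟨b, t, u⟩
  · have hb := b.ne_zero
    simp only [levelParam, Qn]
    field_simp
    ring
  · rw [Qn_eq_iff (levelParam_inr_a_ne_zero h2 D _), levelParam_H h2, levelParam_G h2]
    have ha := levelParam_inr_a_ne_zero h2 D (b, t, u)
    have ht := t.ne_zero
    by_cases hu : u ^ 2 = D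
    · rw [if_pos hu]
      linear_combination (levelParam D (.inr (b, t, u))).a ^ 2 * hu
    · have ha' : (levelParam D (.inr (b, t, u))).a = (D - u ^ 2) / (4 * t ^ 3) := if_neg hu
      have : 4 * (levelParam D (.inr (b, t, u))).a * t ^ 3 = D - u ^ 2 := by
        rw [ha']
        field_simp
      rw [if_neg hu]
      linear_combination (levelParam D (.inr (b, t, u))).a ^ 2 * this

theorem levelParam_injective (h2 : (2 : k) ≠ 0) (D : k) :
    Function.Injective (levelParam D) := by
  rintro (⟨b, c⟩ | ⟨b, t, u⟩) (⟨b', c'⟩ | ⟨b', t', u'⟩) h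
  · have hb : b = b' := Units.ext (congrArg BinCubic.b h)
    have hc : c = c' := congrArg BinCubic.c h
    rw [hb, hc]
  · exact absurd (congrArg BinCubic.a h).symm (levelParam_inr_a_ne_zero h2 D _)
  · exact absurd (congrArg BinCubic.a h) (levelParam_inr_a_ne_zero h2 D _)
  · have hb : b = b' := congrArg BinCubic.b h
    have ha := levelParam_inr_a_ne_zero h2 D (b', t', u')
    have hG := levelParam_G h2 D b t u
    have hH := levelParam_H h2 D b t u
    simp only [h] at hG hH
    rw [levelParam_G h2] at hG
    rw [levelParam_H h2] at hH
    have hu : u' = u := mul_left_cancel₀ ha hG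
    have hc := mul_left_cancel₀ ha hH
    subst hu
    have ha' := congrArg BinCubic.a h
    simp only [levelParam] at ha'
    have ht : t = t' := by
      split_ifs at ha' hc with hu
      · exact Units.ext ha'
      · exact Units.ext hc.symm
    rw [hb, ht]

theorem exists_levelParam_eq (h2 : (2 : k) ≠ 0) {D : k} (hD : D ≠ 0) {P : BinCubic k}
    (hP : Qn P = D) : ∃ x, levelParam D x = P := by
  have h4 := four_ne_zero_of_two h2
  by_cases ha : P.a = 0
  · have hb : P.b ≠ 0 := by
      intro hb
      simp [Qn, ha, hb] at hP
      exact hD hP.symm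
    refine ⟨.inl (Units.mk0 P.b hb, P.c), ?_⟩
    ext
    · exact ha.symm
    · rfl
    · rfl
    · simp only [levelParam, Units.val_mk0]
      simp only [Qn, ha] at hP
      field_simp
      linear_combination -hP
  · rw [Qn_eq_iff ha] at hP
    obtain ⟨h, hh⟩ : ∃ h, P.a * P.c - P.b ^ 2 = P.a * h :=
      ⟨(P.a * P.c - P.b ^ 2) / P.a, by field_simp⟩
    obtain ⟨u, hu⟩ : ∃ u, P.a ^ 2 * P.d - 3 * P.a * P.b * P.c + 2 * P.b ^ 3 = P.a * u :=
      ⟨(P.a ^ 2 * P.d - 3 * P.a * P.b * P.c + 2 * P.b ^ 3) / P.a, by field_simp⟩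
    rw [hh, hu] at hP
    have hrel : D - u ^ 2 = 4 * P.a * h ^ 3 := by
      refine mul_left_cancel₀ (pow_ne_zero 2 ha) ?_
      linear_combination -hP
    have hc : P.c = h + P.b ^ 2 / P.a := by
      field_simp
      linear_combination hh
    have hd : P.d = (P.a * u + 3 * P.a * P.b * P.c - 2 * P.b ^ 3) / P.a ^ 2 := by
      field_simp
      linear_combination hu
    have hiff : u ^ 2 = D ↔ h = 0 := by
      rw [eq_comm, ← sub_eq_zero, hrel]
      simp [h4, ha]
    by_cases h0 : h = 0
    · refine ⟨.inr (P.b, Units.mk0 P.a ha, u), ?_⟩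
      have huD := hiff.mpr h0
      subst h0
      ext
      · simp [levelParam, huD]
      · rfl
      · simp [levelParam, huD, hc]
      · rw [hd, hc]
        simp [levelParam, huD]
    · refine ⟨.inr (P.b, Units.mk0 h h0, u), ?_⟩
      have huD := mt hiff.mp h0
      have ha' : (D - u ^ 2) / (4 * h ^ 3) = P.a := by
        rw [hrel]
        field_simp
      ext
      · simp [levelParam, huD, ha']
      · rfl
      · simp [levelParam, huD, ha', hc]
      · rw [hd, hc]
        simp [levelParam, huD, ha']

theorem card_level (h2 : (2 : k) ≠ 0) {D : k} (hD : D ≠ 0) :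
    Nat.card {P : BinCubic k // Qn P = D} = Nat.card ((kˣ × k) ⊕ (k × kˣ × k)) := by
  refine (Nat.card_congr (Equiv.ofBijective
    (fun x => ⟨levelParam D x, Qn_levelParam h2 D x⟩) ⟨fun x y h => ?_, fun P => ?_⟩)).symm
  · exact levelParam_injective h2 D (congrArg Subtype.val h)
  · obtain ⟨x, hx⟩ := exists_levelParam_eq h2 hD P.2
    exact ⟨x, Subtype.ext hx⟩

/-- A parametrization of `SL(2,k)` according to whether the upper left entry vanishes. -/
def slParam : (kˣ × k) ⊕ (k × kˣ × k) → SpecialLinearGroup (Fin 2) k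
  | .inl (b, d) => ⟨!![0, b; -(b : k)⁻¹, d], by simp [Matrix.det_fin_two]⟩
  | .inr (b, a, c) => ⟨!![a, b; c, (1 + b * c) / a], by
      have := a.ne_zero
      rw [Matrix.det_fin_two_of]
      field_simp
      ring⟩

theorem slParam_bijective : Function.Bijective (slParam (k := k)) := by
  constructor
  · rintro (⟨b, d⟩ | ⟨b, a, c⟩) (⟨b', d'⟩ | ⟨b', a', c'⟩) h
    · have h01 : (b : k) = b' := congrFun₂ (congrArg Subtype.val h) 0 1
      have h11 : d = d' := congrFun₂ (congrArg Subtype.val h) 1 1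
      rw [Units.ext h01, h11]
    · exact absurd (congrFun₂ (congrArg Subtype.val h) 0 0).symm a'.ne_zero
    · exact absurd (congrFun₂ (congrArg Subtype.val h) 0 0) a.ne_zero
    · have h00 : (a : k) = a' := congrFun₂ (congrArg Subtype.val h) 0 0
      have h01 : b = b' := congrFun₂ (congrArg Subtype.val h) 0 1
      have h10 : c = c' := congrFun₂ (congrArg Subtype.val h) 1 0
      rw [Units.ext h00, h01, h10]
  · intro g
    have hdet := det_eq_one g
    by_cases ha : g.1 0 0 = 0
    · have hb : g.1 0 1 ≠ 0 := by
        intro hb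
        simp [ha, hb] at hdet
      refine ⟨.inl (Units.mk0 _ hb, g.1 1 1), Subtype.ext (Eq.trans ?_ (Matrix.eta_fin_two g.1).symm)⟩
      have : -(g.1 0 1)⁻¹ = g.1 1 0 := by
        rw [ha] at hdet
        field_simp
        linear_combination hdet
      simp only [slParam, Units.val_mk0, ha, this]
    · refine ⟨.inr (g.1 0 1, Units.mk0 _ ha, g.1 1 0), Subtype.ext (Eq.trans ?_ (Matrix.eta_fin_two g.1).symm)⟩
      have : (1 + g.1 0 1 * g.1 1 0) / g.1 0 0 = g.1 1 1 := by
        field_simp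
        linear_combination -hdet
      simp only [slParam, Units.val_mk0, this]

theorem card_level_eq_card_sl (h2 : (2 : k) ≠ 0) {D : k} (hD : D ≠ 0) :
    Nat.card {P : BinCubic k // Qn P = D} = Nat.card (SpecialLinearGroup (Fin 2) k) :=
  (card_level h2 hD).trans (Nat.card_congr (Equiv.ofBijective _ slParam_bijective))

/-- `SL(2,k)` acts on the binary cubics with nonzero discriminant. -/
instance : MulAction (SpecialLinearGroup (Fin 2) k) {P : BinCubic k // Qn P ≠ 0} where
  smul g P := ⟨g • P.1, by rw [Qn_sl_smul]; exact P.2⟩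
  one_smul P := Subtype.ext (one_smul _ P.1)
  mul_smul g h P := Subtype.ext (mul_smul g h P.1)

theorem card_Qn_ne_zero [Finite k] (h2 : (2 : k) ≠ 0) :
    Nat.card {P : BinCubic k // Qn P ≠ 0} =
      Nat.card kˣ * Nat.card (SpecialLinearGroup (Fin 2) k) := by
  have := Fintype.ofFinite kˣ
  let e : (Σ D : kˣ, {P : BinCubic k // Qn P = D}) ≃ {P : BinCubic k // Qn P ≠ 0} :=
    Equiv.ofBijective (fun x => ⟨x.2.1, by rw [x.2.2]; exact x.1.ne_zero⟩) <| by
      constructor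
      · rintro ⟨D, P, hP⟩ ⟨D', P', hP'⟩ h
        obtain rfl : P = P' := congrArg Subtype.val h
        obtain rfl : D = D' := Units.ext (hP.symm.trans hP')
        rfl
      · rintro ⟨P, hP⟩
        exact ⟨⟨Units.mk0 _ hP, P, rfl⟩, rfl⟩
  rw [← Nat.card_congr e, Nat.card_sigma]
  simp [card_level_eq_card_sl h2 (Units.ne_zero _)]

theorem card_orderThree_pairs [Finite k] (h2 : (2 : k) ≠ 0) (h3 : (3 : k) ≠ 0) :
    Nat.card {x : k × BinCubic k // 4 * x.1 ^ 2 * Qn x.2 = -3} =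
      Nat.card kˣ * Nat.card (SpecialLinearGroup (Fin 2) k) := by
  have := Fintype.ofFinite kˣ
  have h4 := four_ne_zero_of_two h2
  have key (t : kˣ) (P : BinCubic k) :
      4 * (t : k) ^ 2 * Qn P = -3 ↔ Qn P = -3 / (4 * (t : k) ^ 2) := by
    rw [eq_div_iff (mul_ne_zero h4 (pow_ne_zero 2 t.ne_zero)), mul_comm]
  let e : (Σ t : kˣ, {P : BinCubic k // Qn P = -3 / (4 * (t : k) ^ 2)}) ≃
      {x : k × BinCubic k // 4 * x.1 ^ 2 * Qn x.2 = -3} :=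
    Equiv.ofBijective (fun y => ⟨(y.1, y.2.1), (key _ _).mpr y.2.2⟩) <| by
      constructor
      · rintro ⟨t, P, hP⟩ ⟨t', P', hP'⟩ h
        simp only [Subtype.mk.injEq, Prod.mk.injEq] at h
        obtain rfl := Units.ext h.1
        obtain rfl := h.2
        rfl
      · rintro ⟨⟨t, P⟩, h⟩
        have ht : t ≠ 0 := by
          rintro rfl
          simp at h
          exact h3 h
        exact ⟨⟨Units.mk0 t ht, P, (key (Units.mk0 t ht) P).mp h⟩, rfl⟩
  have hD (t : kˣ) : -3 / (4 * (t : k) ^ 2) ≠ 0 :=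
    div_ne_zero (neg_ne_zero.mpr h3) (mul_ne_zero h4 (pow_ne_zero 2 t.ne_zero))
  rw [← Nat.card_congr e, Nat.card_sigma]
  simp [card_level_eq_card_sl h2 (hD _)]

/-- The pairs `(g, P)` with `g • P = P` and `Q_n(P) ≠ 0` have `g = 1` or `g = -1/2 + t μ(P)`. -/
noncomputable def fixedPairsEquiv (h2 : (2 : k) ≠ 0) (h3 : (3 : k) ≠ 0) :
    {P : BinCubic k // Qn P ≠ 0} ⊕ {x : k × BinCubic k // 4 * x.1 ^ 2 * Qn x.2 = -3} ≃
      Σ g : SpecialLinearGroup (Fin 2) k,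
        MulAction.fixedBy {P : BinCubic k // Qn P ≠ 0} g := by
  have hne {x : k × BinCubic k} (h : 4 * x.1 ^ 2 * Qn x.2 = -3) : Qn x.2 ≠ 0 := by
    intro h0
    rw [h0, mul_zero] at h
    exact h3 (neg_eq_zero.mp h.symm)
  refine Equiv.ofBijective (Sum.elim (fun P => ⟨1, P, one_smul _ P⟩)
    (fun x => ⟨orderThree h2 x.1.1 x.1.2 x.2, ⟨x.1.2, hne x.2⟩,
      Subtype.ext (orderThree_smul h2 h3 x.2)⟩)) ⟨?_, ?_⟩
  · have fst_snd {y z : Σ g : SpecialLinearGroup (Fin 2) k,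
        MulAction.fixedBy {P : BinCubic k // Qn P ≠ 0} g} (h : y = z) :
        y.1 = z.1 ∧ y.2.1 = z.2.1 := by
      subst h
      exact ⟨rfl, rfl⟩
    rintro (P | ⟨⟨t, P⟩, h⟩) (P' | ⟨⟨t', P'⟩, h'⟩) he
    · exact congrArg Sum.inl (fst_snd he).2
    · exact absurd (fst_snd he).1.symm (orderThree_ne_one h2 h3 h')
    · exact absurd (fst_snd he).1 (orderThree_ne_one h2 h3 h)
    · obtain ⟨h1, hP⟩ := fst_snd he
      obtain rfl : P = P' := congrArg Subtype.val hP
      obtain rfl : t = t' := orderThree_injective h2 (hne h) (h := h) (h' := h') h1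
      rfl
  · rintro ⟨g, ⟨P, hP⟩, hg⟩
    rcases (sl_smul_eq_self_iff h2 h3 g hP).mp (congrArg Subtype.val hg) with rfl | ⟨t, ht, hgt⟩
    · exact ⟨.inl ⟨P, hP⟩, rfl⟩
    · obtain rfl : g = orderThree h2 t P ht := Subtype.ext hgt
      exact ⟨.inr ⟨(t, P), ht⟩, rfl⟩

theorem card_orbits [Finite k] (h2 : (2 : k) ≠ 0) (h3 : (3 : k) ≠ 0) :
    Nat.card (MulAction.orbitRel.Quotient (SpecialLinearGroup (Fin 2) k)
      {P : BinCubic k // Qn P ≠ 0}) = 2 * Nat.card kˣ := by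
  have h := Nat.card_congr ((fixedPairsEquiv h2 h3).trans
    (MulAction.sigmaFixedByEquivOrbitsProdGroup _ _))
  rw [Nat.card_sum, Nat.card_prod, card_Qn_ne_zero h2, card_orderThree_pairs h2 h3, ← two_mul,
    ← mul_assoc] at h
  exact (Nat.eq_of_mul_eq_mul_right Nat.card_pos h).symm

end Counting

end BinCubic

/-- over a finite field with `q` elements (char ≠ 2, 3), the number of
`SL(2,k)`-orbits of binary cubics with nonzero discriminant is `2(q−1)`. -/
theorem stmt19 {k : Type*} [Field k] [Fintype k]
    (h2 : (2 : k) ≠ 0) (h3 : (3 : k) ≠ 0)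
    (q : ℕ) (hq : Fintype.card k = q) :
    Nat.card (Quot fun P P' : {P : BinCubic k // Qn P ≠ 0} =>
        ∃ g : Matrix.SpecialLinearGroup (Fin 2) k,
          slAct (↑g) (toPoly P.1) = toPoly P'.1) = 2 * (q - 1) := by
  let e : (Quot fun P P' : {P : BinCubic k // Qn P ≠ 0} =>
      ∃ g : Matrix.SpecialLinearGroup (Fin 2) k, slAct (↑g) (toPoly P.1) = toPoly P'.1) ≃
      MulAction.orbitRel.Quotient (Matrix.SpecialLinearGroup (Fin 2) k)
        {P : BinCubic k // Qn P ≠ 0} :=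
    Quot.congrRight fun P P' => by
      rw [MulAction.orbitRel_apply, MulAction.mem_orbit_symm]
      refine exists_congr fun g => ?_
      rw [slAct_toPoly, (toPoly_injective h2 h3).eq_iff, Subtype.ext_iff]
      rfl
  rw [Nat.card_congr e, card_orbits h2 h3, Nat.card_units, Nat.card_eq_fintype_card, hq]
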